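/- (Theorem 1, LNML density.) Fix integers m ≥ 1, n ≥ 1 and reals ν > m−1, σ² > 0, ρ² > 0. Define p̄_n(x^n) = sup_{μ∈ℝ^m, Σ≻0} f(x^n;μ,Σ)·π(μ,Σ;ν,σ²,ρ²) / 𝒞(m,n,ν,σ²,ρ²). Then for every x^n ∈ (ℝ^m)^n, p̄_n(x^n) = (ν^ν / (π^n·(n+ν)^{n+ν}·(1+n/(ρ²ν))))^{m/2} · (Γ_m((n+ν)/2)/Γ_m(ν/2)) · σ^{mν}/|Σ̄_n|^{(n+ν)/2}, and p̄_n is a probability density on (ℝ^m)^n, i.e. ∫_{(ℝ^m)^n} p̄_n(x^n) dx^n = 1. -/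

import Mathlib

open MeasureTheory Matrix Real BigOperators

/-- Likelihood of `n` observations under the `m`-dimensional normal distribution
with mean `μ` and covariance `S`. -/
noncomputable def mvnLik (m n : ℕ) (x : Fin n → Fin m → ℝ) (μ : Fin m → ℝ)
    (S : Matrix (Fin m) (Fin m) ℝ) : ℝ :=
  ∏ i : Fin n, (2 * π) ^ (-(m : ℝ) / 2) * S.det ^ (-(1 : ℝ) / 2) *
    Real.exp (-(1 / 2) * ((x i - μ) ⬝ᵥ (S⁻¹ *ᵥ (x i - μ))))

/-- The simple luckiness function `π(μ, Σ; ν, σ², ρ²)`. -/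
noncomputable def luck (m : ℕ) (μ : Fin m → ℝ) (S : Matrix (Fin m) (Fin m) ℝ)
    (ν σ2 ρ2 : ℝ) : ℝ :=
  (2 * π) ^ (-(m : ℝ) * ν / 2) * S.det ^ (-ν / 2) *
    Real.exp (-(ν / 2) *
      (S⁻¹ * (σ2 • (1 : Matrix (Fin m) (Fin m) ℝ) + ρ2 • vecMulVec μ μ)).trace)

/-- The generalized luckiness function `π(μ, Σ; ν, μ₀, Σ₀, ρ²)`. -/
noncomputable def luck2 (m : ℕ) (μ : Fin m → ℝ) (S : Matrix (Fin m) (Fin m) ℝ)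
    (ν : ℝ) (μ0 : Fin m → ℝ) (S0 : Matrix (Fin m) (Fin m) ℝ) (ρ2 : ℝ) : ℝ :=
  (2 * π) ^ (-(m : ℝ) * ν / 2) * S.det ^ (-ν / 2) *
    Real.exp (-(ν / 2) *
      (S⁻¹ * (S0 + ρ2 • vecMulVec (μ - μ0) (μ - μ0))).trace)

/-- MAP location estimate `μ̄_k` for the simple luckiness. -/
noncomputable def muBar (m k : ℕ) (ν ρ2 : ℝ) (x : Fin k → Fin m → ℝ) : Fin m → ℝ :=
  (1 / (k + ρ2 * ν)) • ∑ i : Fin k, x i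

/-- MAP covariance estimate `Σ̄_k` for the simple luckiness. -/
noncomputable def sigmaBar (m k : ℕ) (ν σ2 ρ2 : ℝ) (x : Fin k → Fin m → ℝ) :
    Matrix (Fin m) (Fin m) ℝ :=
  (1 / (k + ν)) •
      (∑ i : Fin k, vecMulVec (x i) (x i) + (ν * σ2) • (1 : Matrix (Fin m) (Fin m) ℝ))
    - (1 / ((ν + k) * (ρ2 * ν + k))) • ∑ i : Fin k, ∑ j : Fin k, vecMulVec (x i) (x j)

/-- MAP location estimate `μ̄_k` for the generalized luckiness. -/
noncomputable def muBar2 (m k : ℕ) (ν ρ2 : ℝ) (μ0 : Fin m → ℝ)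
    (x : Fin k → Fin m → ℝ) : Fin m → ℝ :=
  μ0 + (1 / (k + ρ2 * ν)) • ∑ i : Fin k, (x i - μ0)

/-- MAP covariance estimate `Σ̄_k` for the generalized luckiness. -/
noncomputable def sigmaBar2 (m k : ℕ) (ν ρ2 : ℝ) (μ0 : Fin m → ℝ)
    (S0 : Matrix (Fin m) (Fin m) ℝ) (x : Fin k → Fin m → ℝ) : Matrix (Fin m) (Fin m) ℝ :=
  (1 / (k + ν)) • (∑ i : Fin k, vecMulVec (x i - μ0) (x i - μ0) + ν • S0)
    - (1 / ((ν + k) * (ρ2 * ν + k))) •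
        ∑ i : Fin k, ∑ j : Fin k, vecMulVec (x i - μ0) (x j - μ0)

/-- The multivariate gamma function `Γ_m(z)`. -/
noncomputable def multiGamma (m : ℕ) (z : ℝ) : ℝ :=
  π ^ ((m : ℝ) * ((m : ℝ) - 1) / 4) * ∏ j : Fin m, Real.Gamma (z - (j : ℝ) / 2)

/-- The capacity `𝒞(m, n, ν, σ², ρ²)` (note: the fourth argument is `σ²`,
so `σ^{-mν} = (σ²)^{-mν/2}`). -/
noncomputable def capC (m n : ℕ) (ν σ2 ρ2 : ℝ) : ℝ :=
  σ2 ^ (-(m : ℝ) * ν / 2) *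
    ((((n : ℝ) + ν) ^ ((n : ℝ) + ν) * (1 + n / (ρ2 * ν))) /
        ((2 * Real.exp 1) ^ ((n : ℝ) + ν) * (π * ν) ^ ν)) ^ ((m : ℝ) / 2) *
    (multiGamma m (ν / 2) / multiGamma m (((n : ℝ) + ν) / 2))

/-- The pointwise supremum of likelihood times simple luckiness over all `μ`
and positive definite `Σ`. -/
noncomputable def supLik (m n : ℕ) (ν σ2 ρ2 : ℝ) (x : Fin n → Fin m → ℝ) : ℝ :=
  ⨆ p : (Fin m → ℝ) × {S : Matrix (Fin m) (Fin m) ℝ // S.PosDef},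
    mvnLik m n x p.1 p.2.1 * luck m p.1 p.2.1 ν σ2 ρ2

/-- The pointwise supremum of likelihood times generalized luckiness over all `μ`
and positive definite `Σ`. -/
noncomputable def supLik2 (m n : ℕ) (ν : ℝ) (μ0 : Fin m → ℝ)
    (S0 : Matrix (Fin m) (Fin m) ℝ) (ρ2 : ℝ) (x : Fin n → Fin m → ℝ) : ℝ :=
  ⨆ p : (Fin m → ℝ) × {S : Matrix (Fin m) (Fin m) ℝ // S.PosDef},
    mvnLik m n x p.1 p.2.1 * luck2 m p.1 p.2.1 ν μ0 S0 ρ2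

/-- The density of the `m`-variate Student t-distribution with `d` degrees of
freedom, location `μ` and scale matrix `S`. -/
noncomputable def tDens (m : ℕ) (d : ℝ) (x μ : Fin m → ℝ)
    (S : Matrix (Fin m) (Fin m) ℝ) : ℝ :=
  Real.Gamma ((d + m) / 2) /
      (Real.Gamma (d / 2) * (d * π) ^ ((m : ℝ) / 2) * S.det ^ ((1 : ℝ) / 2)) *
    (1 + (1 / d) * ((x - μ) ⬝ᵥ (S⁻¹ *ᵥ (x - μ)))) ^ (-(d + (m : ℝ)) / 2)

open scoped MatrixOrder Matrix.Norms.L2Operator in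
theorem posDef_exists_transpose_mul_self {m : ℕ} {M : Matrix (Fin m) (Fin m) ℝ} (hM : M.PosDef) :
    ∃ B : Matrix (Fin m) (Fin m) ℝ, M = Bᵀ * B ∧ B.det ≠ 0 := by
  have key : ∃ B : Matrix (Fin m) (Fin m) ℝ, M = Bᵀ * B := by
    obtain ⟨B, hB⟩ := CStarAlgebra.nonneg_iff_eq_star_mul_self.mp hM.posSemidef.nonneg
    exact ⟨B, by simpa [star_eq_conjTranspose] using hB⟩
  obtain ⟨B, hB⟩ := key
  refine ⟨B, hB, fun h => hM.det_pos.ne' ?_⟩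
  rw [hB, det_mul, h, mul_zero]

theorem posSemidef_smul_vecMulVec_self {m : ℕ} {t : ℝ} (ht : 0 ≤ t) (v : Fin m → ℝ) :
    (t • vecMulVec v v).PosSemidef := by
  simpa using (posSemidef_vecMulVec_self_star v).smul ht

theorem det_add_smul_vecMulVec {m : ℕ} {M : Matrix (Fin m) (Fin m) ℝ} (hM : IsUnit M.det)
    (t : ℝ) (v : Fin m → ℝ) :
    (M + t • vecMulVec v v).det = M.det * (1 + t * (v ⬝ᵥ (M⁻¹ *ᵥ v))) := by
  have h := det_add_replicateCol_mul_replicateRow (ι := Unit) hM (t • v) v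
  rw [← vecMulVec_eq, smul_vecMulVec] at h
  rw [h, det_unique (1 + _), Matrix.add_apply, one_apply_eq, Matrix.mul_assoc,
    ← replicateCol_mulVec, replicateRow_mul_replicateCol_apply, mulVec_smul, dotProduct_smul,
    smul_eq_mul]

theorem lintegral_ofReal_of_integral_pos {α : Type*} [MeasurableSpace α] {κ : Measure α}
    {f : α → ℝ} (hf : 0 ≤ᵐ[κ] f) {c : ℝ} (hc : 0 < c) (h : ∫ x, f x ∂κ = c) :
    ∫⁻ x, ENNReal.ofReal (f x) ∂κ = ENNReal.ofReal c := by
  rw [← h, ofReal_integral_eq_lintegral_ofReal _ hf]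
  by_contra hi
  rw [integral_undef hi] at h
  exact hc.ne h

theorem lintegral_rpow_mul_exp_neg_mul {a r : ℝ} (ha : 0 < a) (hr : 0 < r) :
    ∫⁻ s in Set.Ioi (0 : ℝ), ENNReal.ofReal (s ^ (a - 1) * Real.exp (-(r * s))) =
      ENNReal.ofReal ((1 / r) ^ a * Real.Gamma a) := by
  refine lintegral_ofReal_of_integral_pos ?_ ?_ (Real.integral_rpow_mul_exp_neg_mul_Ioi ha hr)
  · filter_upwards [ae_restrict_mem measurableSet_Ioi] with s hs
    have hs' : (0 : ℝ) < s := hs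
    simp only [Pi.zero_apply]
    positivity
  · have := Real.Gamma_pos_of_pos ha
    positivity

theorem lintegral_exp_neg_mul_dotProduct (m : ℕ) {b : ℝ} (hb : 0 < b) :
    ∫⁻ y : Fin m → ℝ, ENNReal.ofReal (Real.exp (-(b * (y ⬝ᵥ y)))) =
      ENNReal.ofReal ((π / b) ^ ((m : ℝ) / 2)) := by
  refine lintegral_ofReal_of_integral_pos (Filter.Eventually.of_forall fun _ => (exp_pos _).le)
    (by positivity) ?_
  have h : ∀ y : Fin m → ℝ, Real.exp (-(b * (y ⬝ᵥ y))) = ∏ i, Real.exp (-b * y i ^ 2) := by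
    intro y
    rw [← Real.exp_sum, dotProduct, Finset.mul_sum, ← Finset.sum_neg_distrib]
    congr 1
    exact Finset.sum_congr rfl fun i _ => by ring
  simp_rw [h]
  rw [integral_fintype_prod_volume_eq_pow (fun t : ℝ => Real.exp (-b * t ^ 2)), integral_gaussian,
    Fintype.card_fin, Real.sqrt_eq_rpow, ← Real.rpow_natCast, ← Real.rpow_mul (by positivity)]
  congr 1
  ring

theorem lintegral_one_add_dotProduct_rpow (m : ℕ) {a : ℝ} (ha : (m : ℝ) / 2 < a) :
    ∫⁻ y : Fin m → ℝ, ENNReal.ofReal ((1 + y ⬝ᵥ y) ^ (-a)) =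
      ENNReal.ofReal (π ^ ((m : ℝ) / 2) * Real.Gamma (a - m / 2) / Real.Gamma a) := by
  have ha0 : 0 < a := lt_of_le_of_lt (by positivity) ha
  have hG := Real.Gamma_pos_of_pos ha0
  have hGm := Real.Gamma_pos_of_pos (sub_pos.2 ha)
  have hpos : ∀ y : Fin m → ℝ, 0 < 1 + y ⬝ᵥ y := fun y => by
    have : 0 ≤ y ⬝ᵥ y := Finset.sum_nonneg fun i _ => mul_self_nonneg _
    linarith
  have hy : ∀ y : Fin m → ℝ, ENNReal.ofReal ((1 + y ⬝ᵥ y) ^ (-a)) =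
      ENNReal.ofReal (Real.Gamma a)⁻¹ * ∫⁻ s in Set.Ioi (0 : ℝ),
        ENNReal.ofReal (s ^ (a - 1) * Real.exp (-((1 + y ⬝ᵥ y) * s))) := by
    intro y
    rw [lintegral_rpow_mul_exp_neg_mul ha0 (hpos y), ← ENNReal.ofReal_mul (by positivity)]
    congr 1
    rw [Real.rpow_neg (hpos y).le, one_div, Real.inv_rpow (hpos y).le]
    field_simp
  simp_rw [hy]
  have hmeas : Measurable fun p : (Fin m → ℝ) × ℝ =>
      ENNReal.ofReal (p.2 ^ (a - 1) * Real.exp (-((1 + p.1 ⬝ᵥ p.1) * p.2))) := by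
    simp only [dotProduct]
    fun_prop
  rw [lintegral_const_mul _ hmeas.lintegral_prod_right', lintegral_lintegral_swap hmeas.aemeasurable]
  have hs : ∀ s ∈ Set.Ioi (0 : ℝ), ∫⁻ y : Fin m → ℝ,
      ENNReal.ofReal (s ^ (a - 1) * Real.exp (-((1 + y ⬝ᵥ y) * s))) =
      ENNReal.ofReal (π ^ ((m : ℝ) / 2)) *
        ENNReal.ofReal (s ^ ((a - m / 2) - 1) * Real.exp (-(1 * s))) := by
    intro s hs
    have hs' : 0 < s := hs
    have h1 : ∀ y : Fin m → ℝ, ENNReal.ofReal (s ^ (a - 1) * Real.exp (-((1 + y ⬝ᵥ y) * s))) =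
        ENNReal.ofReal (s ^ (a - 1) * Real.exp (-s)) *
          ENNReal.ofReal (Real.exp (-(s * (y ⬝ᵥ y)))) := by
      intro y
      rw [← ENNReal.ofReal_mul (by positivity), mul_assoc, ← Real.exp_add]
      congr 3
      ring
    simp_rw [h1]
    rw [lintegral_const_mul _ (by simp only [dotProduct]; fun_prop),
      lintegral_exp_neg_mul_dotProduct m hs', ← ENNReal.ofReal_mul (by positivity),
      ← ENNReal.ofReal_mul (by positivity), Real.div_rpow pi_pos.le hs'.le,
      show a - (m : ℝ) / 2 - 1 = (a - 1) - m / 2 by ring, Real.rpow_sub hs' (a - 1)]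
    congr 1
    rw [one_mul]
    ring
  rw [setLIntegral_congr_fun measurableSet_Ioi hs, lintegral_const_mul _ (by fun_prop),
    lintegral_rpow_mul_exp_neg_mul (sub_pos.2 ha) one_pos, ← ENNReal.ofReal_mul (by positivity),
    ← ENNReal.ofReal_mul (by positivity)]
  congr 1
  simp
  ring

theorem lintegral_comp_mulVec {m : ℕ} {B : Matrix (Fin m) (Fin m) ℝ} (hB : B.det ≠ 0)
    {g : (Fin m → ℝ) → ENNReal} (hg : Measurable g) :
    ∫⁻ v, g (B *ᵥ v) = ENNReal.ofReal |B.det|⁻¹ * ∫⁻ y, g y := by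
  have h := Real.map_matrix_volume_pi_eq_smul_volume_pi hB
  have hB' : Measurable (toLin' B) := (LinearMap.continuous_on_pi _).measurable
  rw [← abs_inv, ← smul_eq_mul, ← lintegral_smul_measure, ← h, lintegral_map hg hB']
  rfl

theorem lintegral_det_add_smul_vecMulVec_rpow {m : ℕ} {M : Matrix (Fin m) (Fin m) ℝ}
    (hM : M.PosDef) {t a : ℝ} (ht : 0 < t) (ha : (m : ℝ) / 2 < a) (u : Fin m → ℝ) :
    ∫⁻ x : Fin m → ℝ, ENNReal.ofReal ((M + t • vecMulVec (x - u) (x - u)).det ^ (-a)) =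
      ENNReal.ofReal (t ^ (-(m : ℝ) / 2) * M.det ^ (-(a - 1 / 2)) *
        (π ^ ((m : ℝ) / 2) * Real.Gamma (a - m / 2) / Real.Gamma a)) := by
  have ha0 : 0 < a := lt_of_le_of_lt (by positivity) ha
  have hG := Real.Gamma_pos_of_pos ha0
  have hGm := Real.Gamma_pos_of_pos (sub_pos.2 ha)
  have hd := hM.det_pos
  rw [lintegral_sub_right_eq_self
    (fun v => ENNReal.ofReal ((M + t • vecMulVec v v).det ^ (-a))) u]
  obtain ⟨B, hB, hB0⟩ := posDef_exists_transpose_mul_self (hM.inv.smul ht)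
  have hquad : ∀ v, t * (v ⬝ᵥ (M⁻¹ *ᵥ v)) = (B *ᵥ v) ⬝ᵥ (B *ᵥ v) := by
    intro v
    rw [← smul_eq_mul, ← dotProduct_smul, ← smul_mulVec, hB, ← mulVec_mulVec,
      dotProduct_mulVec, vecMul_transpose]
  have hpos : ∀ y : Fin m → ℝ, 0 < 1 + y ⬝ᵥ y := fun y => by
    have : 0 ≤ y ⬝ᵥ y := Finset.sum_nonneg fun i _ => mul_self_nonneg _
    linarith
  have h1 : ∀ v, ENNReal.ofReal ((M + t • vecMulVec v v).det ^ (-a)) =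
      ENNReal.ofReal (M.det ^ (-a)) *
        (fun y => ENNReal.ofReal ((1 + y ⬝ᵥ y) ^ (-a))) (B *ᵥ v) := by
    intro v
    rw [det_add_smul_vecMulVec hd.ne'.isUnit, hquad, Real.mul_rpow hd.le (hpos _).le,
      ENNReal.ofReal_mul (by positivity)]
  have hg : Measurable fun y : Fin m → ℝ => ENNReal.ofReal ((1 + y ⬝ᵥ y) ^ (-a)) := by
    simp only [dotProduct]
    fun_prop
  have hdet : |B.det|⁻¹ = t ^ (-(m : ℝ) / 2) * M.det ^ ((1 : ℝ) / 2) := by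
    have h2 : B.det ^ 2 = t ^ m * M.det⁻¹ := by
      have := congrArg det hB
      rw [det_mul, det_transpose, det_smul, det_nonsing_inv, Fintype.card_fin,
        Ring.inverse_eq_inv'] at this
      rw [this, sq]
    rw [← Real.sqrt_sq_eq_abs, h2, Real.sqrt_mul (by positivity), mul_inv, Real.sqrt_inv, inv_inv,
      Real.sqrt_eq_rpow, Real.sqrt_eq_rpow, neg_div, Real.rpow_neg ht.le, ← Real.rpow_natCast,
      ← Real.rpow_mul ht.le, mul_one_div]
  rw [lintegral_congr h1, lintegral_const_mul' _ _ ENNReal.ofReal_ne_top, lintegral_comp_mulVec hB0 hg,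
    lintegral_one_add_dotProduct_rpow m ha, hdet, ← ENNReal.ofReal_mul (by positivity),
    ← ENNReal.ofReal_mul (by positivity), neg_sub, show (1 : ℝ) / 2 - a = -a + 1 / 2 by ring,
    Real.rpow_add hd]
  congr 1
  ring

/-- The scatter matrix `M + ∑ xᵢxᵢᵀ - (c + k)⁻¹ (∑ xᵢ)(∑ xᵢ)ᵀ`, shrunk towards `M`. -/
noncomputable def shrunkScatter {m k : ℕ} (c : ℝ) (M : Matrix (Fin m) (Fin m) ℝ)
    (x : Fin k → Fin m → ℝ) : Matrix (Fin m) (Fin m) ℝ :=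
  M + ∑ i, vecMulVec (x i) (x i) - (1 / (c + k)) • vecMulVec (∑ i, x i) (∑ i, x i)

theorem shrunkScatter_cons {m k : ℕ} {c : ℝ} (hc : 0 < c) (M : Matrix (Fin m) (Fin m) ℝ)
    (x : Fin m → ℝ) (y : Fin k → Fin m → ℝ) :
    shrunkScatter c M (Fin.cons x y : Fin (k + 1) → Fin m → ℝ) = shrunkScatter c M y +
      ((c + k) / (c + k + 1)) •
        vecMulVec (x - (1 / (c + k)) • ∑ i, y i) (x - (1 / (c + k)) • ∑ i, y i) := by
  have h1 : c + k ≠ 0 := by positivity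
  have h2 : c + k + 1 ≠ 0 := by positivity
  ext i j
  simp only [shrunkScatter, Fin.sum_univ_succ, Fin.cons_zero, Fin.cons_succ, Matrix.add_apply,
    Matrix.sub_apply, Matrix.smul_apply, vecMulVec_apply, Pi.add_apply, Pi.sub_apply, Pi.smul_apply,
    smul_eq_mul, Nat.cast_add, Nat.cast_one, ← add_assoc]
  field_simp
  ring

theorem shrunkScatter_posDef {m k : ℕ} {c : ℝ} (hc : 0 < c) {M : Matrix (Fin m) (Fin m) ℝ}
    (hM : M.PosDef) (x : Fin k → Fin m → ℝ) : (shrunkScatter c M x).PosDef := by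
  induction k with
  | zero => simpa [shrunkScatter] using hM
  | succ k ih =>
    rw [← Fin.cons_self_tail x, shrunkScatter_cons hc]
    exact (ih _).add_posSemidef (posSemidef_smul_vecMulVec_self (by positivity) _)

theorem continuous_shrunkScatter {m k : ℕ} (c : ℝ) (M : Matrix (Fin m) (Fin m) ℝ) :
    Continuous fun x : Fin k → Fin m → ℝ => shrunkScatter c M x := by
  unfold shrunkScatter
  have hs : Continuous fun x : Fin k → Fin m → ℝ => ∑ i, x i := by fun_prop
  exact (continuous_const.add (continuous_finsetSum _ fun i _ =>
    (continuous_apply i).matrix_vecMulVec (continuous_apply i))).sub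
      ((hs.matrix_vecMulVec hs).const_smul (1 / (c + k)))

theorem multiGamma_pos {m : ℕ} {z : ℝ} (hz : ((m : ℝ) - 1) / 2 < z) : 0 < multiGamma m z := by
  refine mul_pos (by positivity) (Finset.prod_pos fun j _ => Real.Gamma_pos_of_pos ?_)
  have : (j : ℝ) + 1 ≤ m := by exact_mod_cast j.2
  linarith

theorem multiGamma_add_half (m : ℕ) (z : ℝ) :
    multiGamma m (z + 1 / 2) * Real.Gamma (z + 1 / 2 - m / 2) =
      multiGamma m z * Real.Gamma (z + 1 / 2) := by
  have h1 := Fin.prod_univ_castSucc fun j : Fin (m + 1) => Real.Gamma (z + 1 / 2 - (j : ℝ) / 2)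
  rw [Fin.prod_univ_succ] at h1
  simp only [Fin.val_zero, Fin.val_succ, Fin.val_castSucc, Fin.val_last, Nat.cast_zero,
    zero_div, sub_zero, Nat.cast_add, Nat.cast_one] at h1
  have h2 : ∀ j : Fin m, z + 1 / 2 - ((j : ℝ) + 1) / 2 = z - j / 2 := fun j => by ring
  simp only [h2] at h1
  rw [multiGamma, multiGamma, mul_assoc, ← h1]
  ring

theorem lintegral_det_shrunkScatter_rpow {m : ℕ} (k : ℕ) {c ν : ℝ} (hc : 0 < c)
    (hν : (m : ℝ) - 1 < ν) (hν0 : 0 < ν) {M : Matrix (Fin m) (Fin m) ℝ} (hM : M.PosDef) :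
    ∫⁻ x : Fin k → Fin m → ℝ,
        ENNReal.ofReal ((shrunkScatter c M x).det ^ (-(((k : ℝ) + ν) / 2))) =
      ENNReal.ofReal (π ^ ((k : ℝ) * m / 2) * ((c + k) / c) ^ ((m : ℝ) / 2) * M.det ^ (-(ν / 2)) *
        (multiGamma m (ν / 2) / multiGamma m (((k : ℝ) + ν) / 2))) := by
  have hd := hM.det_pos
  induction k with
  | zero =>
    have hG : multiGamma m (ν / 2) ≠ 0 := (multiGamma_pos (by linarith)).ne'
    simp [shrunkScatter, volume_pi, hc.ne', hG]
  | succ k ih =>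
    have hk : (0 : ℝ) ≤ k := k.cast_nonneg
    have hG := multiGamma_pos (m := m) (z := ν / 2) (by linarith)
    have hGk := multiGamma_pos (m := m) (z := ((k : ℝ) + ν) / 2) (by linarith)
    have hGk1 := multiGamma_pos (m := m) (z := ((k : ℝ) + ν) / 2 + 1 / 2) (by linarith)
    have hg1 := Real.Gamma_pos_of_pos (s := ((k : ℝ) + ν) / 2 + 1 / 2) (by linarith)
    have hg2 := Real.Gamma_pos_of_pos (s := ((k : ℝ) + ν) / 2 + 1 / 2 - m / 2) (by linarith)
    have hmeas : Measurable fun x : Fin (k + 1) → Fin m → ℝ =>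
        ENNReal.ofReal ((shrunkScatter c M x).det ^ (-(((k + 1 : ℕ) + ν) / 2))) :=
      ((continuous_shrunkScatter c M).matrix_det.measurable.pow_const _).ennreal_ofReal
    have he := (volume_preserving_piFinSuccAbove (fun _ : Fin (k + 1) => Fin m → ℝ) 0).symm
    rw [← he.lintegral_comp hmeas]
    refine (lintegral_prod_symm' _ (hmeas.comp he.measurable)).trans ?_
    simp only [Function.comp_apply]
    have hexp : (((k + 1 : ℕ) : ℝ) + ν) / 2 = ((k : ℝ) + ν) / 2 + 1 / 2 := by push_cast; ring
    have hstep : ∀ y : Fin k → Fin m → ℝ, ∫⁻ x : Fin m → ℝ, ENNReal.ofReal ((shrunkScatter c M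
        ((MeasurableEquiv.piFinSuccAbove (fun _ : Fin (k + 1) => Fin m → ℝ) 0).symm (x, y))).det ^
          (-(((k + 1 : ℕ) + ν) / 2))) =
        ENNReal.ofReal (((c + k) / (c + k + 1)) ^ (-(m : ℝ) / 2) * (π ^ ((m : ℝ) / 2) *
          Real.Gamma (((k : ℝ) + ν) / 2 + 1 / 2 - m / 2) /
            Real.Gamma (((k : ℝ) + ν) / 2 + 1 / 2))) *
          ENNReal.ofReal ((shrunkScatter c M y).det ^ (-(((k : ℝ) + ν) / 2))) := by
      intro y
      have hcons : ∀ x, (MeasurableEquiv.piFinSuccAbove (fun _ : Fin (k + 1) => Fin m → ℝ) 0).symm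
          (x, y) = Fin.cons x y := fun x => by
        simp [MeasurableEquiv.piFinSuccAbove_symm_apply, Fin.insertNthEquiv]
      simp_rw [hcons, shrunkScatter_cons hc, hexp]
      rw [lintegral_det_add_smul_vecMulVec_rpow (shrunkScatter_posDef hc hM y) (by positivity)
        (by linarith), ← ENNReal.ofReal_mul (by positivity)]
      congr 1
      rw [add_sub_cancel_right]
      ring
    rw [lintegral_congr hstep, lintegral_const_mul' _ _ ENNReal.ofReal_ne_top, ih,
      ← ENNReal.ofReal_mul (by positivity)]
    congr 1
    rw [hexp]
    have hgam : multiGamma m (ν / 2) / multiGamma m (((k : ℝ) + ν) / 2 + 1 / 2) =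
        Real.Gamma (((k : ℝ) + ν) / 2 + 1 / 2 - m / 2) / Real.Gamma (((k : ℝ) + ν) / 2 + 1 / 2) *
          (multiGamma m (ν / 2) / multiGamma m (((k : ℝ) + ν) / 2)) := by
      have := multiGamma_add_half m (((k : ℝ) + ν) / 2)
      rw [div_mul_div_comm, div_eq_div_iff hGk1.ne' (mul_pos hg1 hGk).ne']
      linear_combination -multiGamma m (ν / 2) * this
    have hpi : π ^ (((k + 1 : ℕ) : ℝ) * m / 2) = π ^ ((m : ℝ) / 2) * π ^ ((k : ℝ) * m / 2) := by
      rw [← Real.rpow_add pi_pos]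
      congr 1
      push_cast
      ring
    have hratio : ((c + (k + 1 : ℕ)) / c) ^ ((m : ℝ) / 2) =
        ((c + k) / (c + k + 1)) ^ (-(m : ℝ) / 2) * ((c + k) / c) ^ ((m : ℝ) / 2) := by
      rw [neg_div, Real.rpow_neg (by positivity), ← Real.inv_rpow (by positivity),
        ← Real.mul_rpow (by positivity) (by positivity)]
      congr 1
      push_cast
      field_simp
      ring
    rw [hgam, hpi, hratio]
    ring

theorem sigmaBar_eq_smul_shrunkScatter {m n : ℕ} {ν ρ2 : ℝ} (hν : 0 < ν) (hρ : 0 < ρ2) (σ2 : ℝ)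
    (x : Fin n → Fin m → ℝ) :
    sigmaBar m n ν σ2 ρ2 x = (1 / ((n : ℝ) + ν)) •
      shrunkScatter (ρ2 * ν) ((ν * σ2) • (1 : Matrix (Fin m) (Fin m) ℝ)) x := by
  have h1 : (n : ℝ) + ν ≠ 0 := by positivity
  have h2 : ν + (n : ℝ) ≠ 0 := by positivity
  have h3 : ρ2 * ν + (n : ℝ) ≠ 0 := by positivity
  ext i j
  simp only [sigmaBar, shrunkScatter, Matrix.add_apply, Matrix.sub_apply, Matrix.smul_apply,
    Matrix.sum_apply, vecMulVec_apply, Finset.sum_apply, smul_eq_mul, ← Finset.sum_mul_sum]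
  field_simp
  ring

theorem sigmaBar_posDef {m n : ℕ} {ν σ2 ρ2 : ℝ} (hν : 0 < ν) (hσ : 0 < σ2) (hρ : 0 < ρ2)
    (x : Fin n → Fin m → ℝ) : (sigmaBar m n ν σ2 ρ2 x).PosDef := by
  rw [sigmaBar_eq_smul_shrunkScatter hν hρ]
  exact (shrunkScatter_posDef (by positivity) (PosDef.one.smul (by positivity)) x).smul
    (by positivity)

theorem det_le_exp_trace_sub {m : ℕ} {W : Matrix (Fin m) (Fin m) ℝ} (hW : W.PosDef) :
    W.det ≤ Real.exp (W.trace - m) := by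
  have h : W.trace - m = ∑ i, (hW.isHermitian.eigenvalues i - 1) := by
    simp [hW.isHermitian.trace_eq_sum_eigenvalues]
  rw [hW.isHermitian.det_eq_prod_eigenvalues, h, Real.exp_sum]
  refine Finset.prod_le_prod (fun i _ => (hW.eigenvalues_pos i).le) fun i _ => ?_
  simpa using Real.add_one_le_exp (hW.isHermitian.eigenvalues i - 1)

theorem det_rpow_mul_exp_trace_le {m : ℕ} {S T : Matrix (Fin m) (Fin m) ℝ} (hS : S.PosDef)
    (hT : T.PosDef) {a : ℝ} (ha : 0 ≤ a) :
    S.det ^ (-a) * Real.exp (-(a * (S⁻¹ * T).trace)) ≤ T.det ^ (-a) * Real.exp (-(a * m)) := by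
  obtain ⟨B, hB, hB0⟩ := posDef_exists_transpose_mul_self hT
  have hW : (B * S⁻¹ * Bᵀ).PosDef := by
    have := hS.inv.mul_mul_conjTranspose_same (B := B)
      (vecMul_injective_of_isUnit ((isUnit_iff_isUnit_det B).2 hB0.isUnit))
    simpa using this
  have h := det_le_exp_trace_sub hW
  have hdS := hS.det_pos
  have hdT := hT.det_pos
  have htr : (B * S⁻¹ * Bᵀ).trace = (S⁻¹ * T).trace := by
    rw [hB, Matrix.mul_assoc, trace_mul_comm, Matrix.mul_assoc]
  have hdet : (B * S⁻¹ * Bᵀ).det = T.det / S.det := by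
    rw [hB, det_mul, det_mul, det_mul, det_nonsing_inv, Ring.inverse_eq_inv']
    ring
  rw [htr, hdet] at h
  have h2 := Real.rpow_le_rpow (by positivity) h ha
  rw [← Real.exp_mul, Real.div_rpow hdT.le hdS.le] at h2
  have hTa := Real.rpow_pos_of_pos hdT a
  have hSa := Real.rpow_pos_of_pos hdS a
  rw [Real.rpow_neg hdS.le, Real.rpow_neg hdT.le]
  calc (S.det ^ a)⁻¹ * Real.exp (-(a * (S⁻¹ * T).trace))
      = (T.det ^ a)⁻¹ * (T.det ^ a / S.det ^ a) * Real.exp (-(a * (S⁻¹ * T).trace)) := by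
        field_simp
    _ ≤ (T.det ^ a)⁻¹ * Real.exp (((S⁻¹ * T).trace - m) * a) *
          Real.exp (-(a * (S⁻¹ * T).trace)) := by gcongr
    _ = (T.det ^ a)⁻¹ * Real.exp (-(a * m)) := by
        rw [mul_assoc, ← Real.exp_add]
        congr 2
        ring

theorem trace_mul_vecMulVec_self {m : ℕ} (P : Matrix (Fin m) (Fin m) ℝ) (v : Fin m → ℝ) :
    (P * vecMulVec v v).trace = v ⬝ᵥ (P *ᵥ v) := by
  rw [mul_vecMulVec, trace_vecMulVec, dotProduct_comm]

theorem sum_vecMulVec_sub_add_eq {m n : ℕ} {ν ρ2 : ℝ} (hν : 0 < ν) (hρ : 0 < ρ2) (σ2 : ℝ)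
    (x : Fin n → Fin m → ℝ) (μ : Fin m → ℝ) :
    ∑ i, vecMulVec (x i - μ) (x i - μ) +
        ν • (σ2 • (1 : Matrix (Fin m) (Fin m) ℝ) + ρ2 • vecMulVec μ μ) =
      ((n : ℝ) + ν) • sigmaBar m n ν σ2 ρ2 x +
        ((n : ℝ) + ρ2 * ν) • vecMulVec (μ - muBar m n ν ρ2 x) (μ - muBar m n ν ρ2 x) := by
  have h1 : (n : ℝ) + ν ≠ 0 := by positivity
  have h3 : ρ2 * ν + (n : ℝ) ≠ 0 := by positivity
  have h4 : (n : ℝ) + ρ2 * ν ≠ 0 := by positivity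
  rw [sigmaBar_eq_smul_shrunkScatter hν hρ, smul_smul, mul_one_div_cancel h1, one_smul]
  ext i j
  simp only [muBar, shrunkScatter, Matrix.add_apply, Matrix.sub_apply, Matrix.smul_apply,
    Matrix.sum_apply, vecMulVec_apply, Finset.sum_apply, smul_eq_mul, Pi.sub_apply, Pi.smul_apply,
    sub_mul, mul_sub, Finset.sum_sub_distrib, ← Finset.sum_mul, ← Finset.mul_sum, Finset.sum_const,
    Finset.card_univ, Fintype.card_fin, nsmul_eq_mul]
  rw [add_comm (ρ2 * ν) (n : ℝ)]
  field_simp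
  ring

theorem mvnLik_mul_luck {m n : ℕ} {ν ρ2 : ℝ} (hν : 0 < ν) (hρ : 0 < ρ2) (σ2 : ℝ)
    (x : Fin n → Fin m → ℝ) (μ : Fin m → ℝ) {S : Matrix (Fin m) (Fin m) ℝ} (hS : S.PosDef) :
    mvnLik m n x μ S * luck m μ S ν σ2 ρ2 =
      (2 * π) ^ (-((m : ℝ) * (((n : ℝ) + ν) / 2))) *
        (S.det ^ (-(((n : ℝ) + ν) / 2)) *
          Real.exp (-(((n : ℝ) + ν) / 2 * (S⁻¹ * sigmaBar m n ν σ2 ρ2 x).trace))) *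
        Real.exp (-(((n : ℝ) + ρ2 * ν) / 2 *
          ((μ - muBar m n ν ρ2 x) ⬝ᵥ (S⁻¹ *ᵥ (μ - muBar m n ν ρ2 x))))) := by
  have hd := hS.det_pos
  have h2π : (0 : ℝ) < 2 * π := by positivity
  have htr := congrArg (fun A => (S⁻¹ * A).trace) (sum_vecMulVec_sub_add_eq hν hρ σ2 x μ)
  simp only [Matrix.mul_add, Matrix.mul_sum, trace_add, trace_sum, Matrix.mul_smul, trace_smul,
    trace_mul_vecMulVec_self, smul_eq_mul, Matrix.mul_one] at htr
  simp only [mvnLik, luck, Finset.prod_mul_distrib, Finset.prod_const, Finset.card_univ,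
    Fintype.card_fin, ← Real.exp_sum, ← Finset.mul_sum, Matrix.mul_add, trace_add, Matrix.mul_smul,
    trace_smul, trace_mul_vecMulVec_self, smul_eq_mul, Matrix.mul_one]
  have e1 : (2 * π) ^ (-((m : ℝ) * (((n : ℝ) + ν) / 2))) =
      ((2 * π) ^ (-(m : ℝ) / 2)) ^ n * (2 * π) ^ (-(m : ℝ) * ν / 2) := by
    rw [← Real.rpow_natCast, ← Real.rpow_mul h2π.le, ← Real.rpow_add h2π]
    congr 1
    ring
  have e2 : S.det ^ (-(((n : ℝ) + ν) / 2)) = (S.det ^ (-(1 : ℝ) / 2)) ^ n * S.det ^ (-ν / 2) := by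
    rw [← Real.rpow_natCast, ← Real.rpow_mul hd.le, ← Real.rpow_add hd]
    congr 1
    ring
  have e3 : Real.exp (-(1 / 2) * ∑ i, (x i - μ) ⬝ᵥ (S⁻¹ *ᵥ (x i - μ))) *
      Real.exp (-(ν / 2) * (σ2 * S⁻¹.trace + ρ2 * (μ ⬝ᵥ (S⁻¹ *ᵥ μ)))) =
      Real.exp (-(((n : ℝ) + ν) / 2 * (S⁻¹ * sigmaBar m n ν σ2 ρ2 x).trace)) *
        Real.exp (-(((n : ℝ) + ρ2 * ν) / 2 *
          ((μ - muBar m n ν ρ2 x) ⬝ᵥ (S⁻¹ *ᵥ (μ - muBar m n ν ρ2 x))))) := by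
    rw [← Real.exp_add, ← Real.exp_add]
    congr 1
    linear_combination (-(1 / 2)) * htr
  rw [e1, e2]
  linear_combination ((2 * π) ^ (-(m : ℝ) / 2)) ^ n * (S.det ^ (-(1 : ℝ) / 2)) ^ n *
    (2 * π) ^ (-(m : ℝ) * ν / 2) * S.det ^ (-ν / 2) * e3

theorem supLik_eq {m n : ℕ} {ν σ2 ρ2 : ℝ} (hν : 0 < ν) (hσ : 0 < σ2) (hρ : 0 < ρ2)
    (x : Fin n → Fin m → ℝ) :
    supLik m n ν σ2 ρ2 x = (2 * π) ^ (-((m : ℝ) * (((n : ℝ) + ν) / 2))) *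
      ((sigmaBar m n ν σ2 ρ2 x).det ^ (-(((n : ℝ) + ν) / 2)) *
        Real.exp (-(((n : ℝ) + ν) / 2 * m))) := by
  have hT := sigmaBar_posDef hν hσ hρ x
  have hle : ∀ p : (Fin m → ℝ) × {S : Matrix (Fin m) (Fin m) ℝ // S.PosDef},
      mvnLik m n x p.1 p.2.1 * luck m p.1 p.2.1 ν σ2 ρ2 ≤
        (2 * π) ^ (-((m : ℝ) * (((n : ℝ) + ν) / 2))) *
          ((sigmaBar m n ν σ2 ρ2 x).det ^ (-(((n : ℝ) + ν) / 2)) *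
            Real.exp (-(((n : ℝ) + ν) / 2 * m))) := by
    rintro ⟨μ, S, hS⟩
    have hd := hS.det_pos
    have hq := hS.inv.posSemidef.dotProduct_mulVec_nonneg (μ - muBar m n ν ρ2 x)
    rw [star_trivial] at hq
    rw [mvnLik_mul_luck hν hρ σ2 x μ hS]
    refine (mul_le_of_le_one_right (by positivity) (Real.exp_le_one_iff.2 ?_)).trans ?_
    · have : 0 ≤ ((n : ℝ) + ρ2 * ν) / 2 := by positivity
      exact neg_nonpos.2 (mul_nonneg this hq)
    · exact mul_le_mul_of_nonneg_left (det_rpow_mul_exp_trace_le hS hT (by positivity))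
        (by positivity)
  have : Nonempty ((Fin m → ℝ) × {S : Matrix (Fin m) (Fin m) ℝ // S.PosDef}) := ⟨(0, ⟨_, hT⟩)⟩
  refine le_antisymm (ciSup_le hle) ?_
  refine le_of_eq_of_le ?_ (le_ciSup ⟨_, Set.forall_mem_range.2 hle⟩ (muBar m n ν ρ2 x, ⟨_, hT⟩))
  rw [mvnLik_mul_luck hν hρ σ2 x _ hT, nonsing_inv_mul _ hT.det_pos.ne'.isUnit]
  simp

theorem supLik_div_capC_eq {m n : ℕ} {ν σ2 ρ2 : ℝ} (hν : (m : ℝ) - 1 < ν) (hν0 : 0 < ν)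
    (hσ : 0 < σ2) (hρ : 0 < ρ2) (x : Fin n → Fin m → ℝ) :
    supLik m n ν σ2 ρ2 x / capC m n ν σ2 ρ2 =
      (ν ^ ν / (π ^ (n : ℝ) * ((n : ℝ) + ν) ^ ((n : ℝ) + ν) *
          (1 + n / (ρ2 * ν)))) ^ ((m : ℝ) / 2) *
        (multiGamma m (((n : ℝ) + ν) / 2) / multiGamma m (ν / 2)) *
        (σ2 ^ ((m : ℝ) * ν / 2) /
          (sigmaBar m n ν σ2 ρ2 x).det ^ (((n : ℝ) + ν) / 2)) := by
  have hn : (0 : ℝ) ≤ n := n.cast_nonneg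
  have hd := (sigmaBar_posDef hν0 hσ hρ x).det_pos
  have hG := multiGamma_pos (m := m) (z := ν / 2) (by linarith)
  have hGn := multiGamma_pos (m := m) (z := ((n : ℝ) + ν) / 2) (by linarith)
  have hN : 0 < (n : ℝ) + ν := by positivity
  have hD := Real.rpow_pos_of_pos hd (((n : ℝ) + ν) / 2)
  have hs := Real.rpow_pos_of_pos hσ ((m : ℝ) * ν / 2)
  have hbase : (2 * π) ^ (-((m : ℝ) * (((n : ℝ) + ν) / 2))) *
      Real.exp (-(((n : ℝ) + ν) / 2 * m)) =
      (ν ^ ν / (π ^ (n : ℝ) * ((n : ℝ) + ν) ^ ((n : ℝ) + ν) *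
          (1 + n / (ρ2 * ν)))) ^ ((m : ℝ) / 2) *
      ((((n : ℝ) + ν) ^ ((n : ℝ) + ν) * (1 + n / (ρ2 * ν))) /
        ((2 * Real.exp 1) ^ ((n : ℝ) + ν) * (π * ν) ^ ν)) ^ ((m : ℝ) / 2) := by
    rw [← Real.mul_rpow (by positivity) (by positivity)]
    have h1 : ν ^ ν / (π ^ (n : ℝ) * ((n : ℝ) + ν) ^ ((n : ℝ) + ν) * (1 + n / (ρ2 * ν))) *
        ((((n : ℝ) + ν) ^ ((n : ℝ) + ν) * (1 + n / (ρ2 * ν))) /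
          ((2 * Real.exp 1) ^ ((n : ℝ) + ν) * (π * ν) ^ ν)) =
        (2 * π * Real.exp 1) ^ (-((n : ℝ) + ν)) := by
      have h2 : 0 < 1 + n / (ρ2 * ν) := by positivity
      rw [Real.rpow_neg (by positivity), Real.mul_rpow (by positivity) (by positivity),
        Real.mul_rpow (by positivity) (by positivity),
        Real.mul_rpow (by positivity) (by positivity),
        Real.mul_rpow (by positivity) (by positivity), Real.rpow_add pi_pos]
      field_simp
    rw [h1, ← Real.rpow_mul (by positivity),
      Real.mul_rpow (x := 2 * π) (by positivity) (by positivity), ← Real.exp_mul]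
    ring_nf
  rw [supLik_eq hν0 hσ hρ, capC, Real.rpow_neg hd.le, neg_mul, neg_div, Real.rpow_neg hσ.le]
  set Y := (ν ^ ν / (π ^ (n : ℝ) * ((n : ℝ) + ν) ^ ((n : ℝ) + ν) *
          (1 + n / (ρ2 * ν)))) ^ ((m : ℝ) / 2)
  set X := ((((n : ℝ) + ν) ^ ((n : ℝ) + ν) * (1 + n / (ρ2 * ν))) /
        ((2 * Real.exp 1) ^ ((n : ℝ) + ν) * (π * ν) ^ ν)) ^ ((m : ℝ) / 2)
  have hXpos : 0 < X := by positivity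
  rw [div_eq_iff (by positivity), mul_left_comm, hbase]
  field_simp

theorem integral_lnml_closed_form_eq_one {m n : ℕ} {ν σ2 ρ2 : ℝ} (hν : (m : ℝ) - 1 < ν)
    (hν0 : 0 < ν) (hσ : 0 < σ2) (hρ : 0 < ρ2) :
    ∫ x : Fin n → Fin m → ℝ, (ν ^ ν / (π ^ (n : ℝ) * ((n : ℝ) + ν) ^ ((n : ℝ) + ν) *
          (1 + n / (ρ2 * ν)))) ^ ((m : ℝ) / 2) *
        (multiGamma m (((n : ℝ) + ν) / 2) / multiGamma m (ν / 2)) *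
        (σ2 ^ ((m : ℝ) * ν / 2) /
          (sigmaBar m n ν σ2 ρ2 x).det ^ (((n : ℝ) + ν) / 2)) = 1 := by
  have hn : (0 : ℝ) ≤ n := n.cast_nonneg
  have hG := multiGamma_pos (m := m) (z := ν / 2) (by linarith)
  have hGn := multiGamma_pos (m := m) (z := ((n : ℝ) + ν) / 2) (by linarith)
  have hN : 0 < (n : ℝ) + ν := by positivity
  have hc : 0 < ρ2 * ν := by positivity
  have hM : ((ν * σ2) • (1 : Matrix (Fin m) (Fin m) ℝ)).PosDef := PosDef.one.smul (by positivity)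
  have hdetM : ((ν * σ2) • (1 : Matrix (Fin m) (Fin m) ℝ)).det = (ν * σ2) ^ m := by
    simp
  have hdet : ∀ x : Fin n → Fin m → ℝ,
      σ2 ^ ((m : ℝ) * ν / 2) / (sigmaBar m n ν σ2 ρ2 x).det ^ (((n : ℝ) + ν) / 2) =
        σ2 ^ ((m : ℝ) * ν / 2) * (((n : ℝ) + ν) ^ ((n : ℝ) + ν)) ^ ((m : ℝ) / 2) *
          (shrunkScatter (ρ2 * ν) ((ν * σ2) • (1 : Matrix (Fin m) (Fin m) ℝ)) x).det ^
            (-(((n : ℝ) + ν) / 2)) := by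
    intro x
    have hd := (shrunkScatter_posDef hc hM x).det_pos
    have hNm : ((1 / ((n : ℝ) + ν)) ^ m) ^ (((n : ℝ) + ν) / 2) =
        ((((n : ℝ) + ν) ^ ((n : ℝ) + ν)) ^ ((m : ℝ) / 2))⁻¹ := by
      rw [one_div, ← Real.rpow_natCast, Real.inv_rpow hN.le, Real.inv_rpow (by positivity),
        ← Real.rpow_mul hN.le, ← Real.rpow_mul hN.le]
      congr 2
      ring
    rw [sigmaBar_eq_smul_shrunkScatter hν0 hρ, det_smul, Fintype.card_fin,
      Real.mul_rpow (by positivity) hd.le, hNm, Real.rpow_neg hd.le]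
    have := Real.rpow_pos_of_pos hd (((n : ℝ) + ν) / 2)
    field_simp
  have hlint := lintegral_det_shrunkScatter_rpow n hc hν hν0 hM
  have hint : ∫ x : Fin n → Fin m → ℝ,
      (shrunkScatter (ρ2 * ν) ((ν * σ2) • (1 : Matrix (Fin m) (Fin m) ℝ)) x).det ^
            (-(((n : ℝ) + ν) / 2)) =
      π ^ ((n : ℝ) * m / 2) * ((ρ2 * ν + n) / (ρ2 * ν)) ^ ((m : ℝ) / 2) *
        ((ν * σ2) ^ m) ^ (-(ν / 2)) *
          (multiGamma m (ν / 2) / multiGamma m (((n : ℝ) + ν) / 2)) := by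
    rw [integral_eq_lintegral_of_nonneg_ae, hlint, hdetM, ENNReal.toReal_ofReal (by positivity)]
    · exact Filter.Eventually.of_forall fun x =>
        Real.rpow_nonneg (shrunkScatter_posDef hc hM x).det_pos.le _
    · exact ((continuous_shrunkScatter _ _).matrix_det.measurable.pow_const _).aestronglyMeasurable
  simp_rw [hdet]
  rw [integral_const_mul, integral_const_mul, hint]
  have h1 : 1 + n / (ρ2 * ν) = (ρ2 * ν + n) / (ρ2 * ν) := by field_simp
  have h2 : π ^ ((n : ℝ) * m / 2) = (π ^ (n : ℝ)) ^ ((m : ℝ) / 2) := by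
    rw [← Real.rpow_mul pi_pos.le, mul_div_assoc]
  have h3 : ((ν * σ2) ^ m) ^ (-(ν / 2)) = ((ν ^ ν) ^ ((m : ℝ) / 2) * σ2 ^ ((m : ℝ) * ν / 2))⁻¹ := by
    rw [← Real.rpow_natCast, ← Real.rpow_mul (by positivity), ← Real.rpow_mul hν0.le,
      show (m : ℝ) * -(ν / 2) = -((m : ℝ) * ν / 2) by ring, Real.rpow_neg (by positivity),
      Real.mul_rpow hν0.le hσ.le, show ν * ((m : ℝ) / 2) = (m : ℝ) * ν / 2 by ring]
  rw [h1, h2, h3, Real.div_rpow (by positivity) (by positivity),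
    Real.mul_rpow (by positivity) (by positivity), Real.mul_rpow (by positivity) (by positivity)]
  have p1 : 0 < ((ρ2 * ν + n) / (ρ2 * ν)) ^ ((m : ℝ) / 2) := by positivity
  have p2 : 0 < (π ^ (n : ℝ)) ^ ((m : ℝ) / 2) := by positivity
  have p3 : 0 < (ν ^ ν) ^ ((m : ℝ) / 2) := by positivity
  have p4 : 0 < (((n : ℝ) + ν) ^ ((n : ℝ) + ν)) ^ ((m : ℝ) / 2) := by positivity
  have p5 : 0 < σ2 ^ ((m : ℝ) * ν / 2) := by positivity
  generalize ((ρ2 * ν + n) / (ρ2 * ν)) ^ ((m : ℝ) / 2) = a1 at *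
  generalize (π ^ (n : ℝ)) ^ ((m : ℝ) / 2) = a2 at *
  generalize (ν ^ ν) ^ ((m : ℝ) / 2) = a3 at *
  generalize (((n : ℝ) + ν) ^ ((n : ℝ) + ν)) ^ ((m : ℝ) / 2) = a4 at *
  generalize σ2 ^ ((m : ℝ) * ν / 2) = a5 at *
  generalize multiGamma m (ν / 2) = g1 at *
  generalize multiGamma m (((n : ℝ) + ν) / 2) = g2 at *
  field_simp

/-- Theorem 1, LNML density: the closed form of the LNML
density and the fact that it integrates to one. -/
theorem lnml_density (m n : ℕ) (hm : 1 ≤ m) (hn : 1 ≤ n) (ν σ2 ρ2 : ℝ)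
    (hν : (m : ℝ) - 1 < ν) (hσ : 0 < σ2) (hρ : 0 < ρ2) :
    (∀ x : Fin n → Fin m → ℝ,
        supLik m n ν σ2 ρ2 x / capC m n ν σ2 ρ2 =
          (ν ^ ν / (π ^ (n : ℝ) * ((n : ℝ) + ν) ^ ((n : ℝ) + ν) *
              (1 + n / (ρ2 * ν)))) ^ ((m : ℝ) / 2) *
            (multiGamma m (((n : ℝ) + ν) / 2) / multiGamma m (ν / 2)) *
            (σ2 ^ ((m : ℝ) * ν / 2) /
              (sigmaBar m n ν σ2 ρ2 x).det ^ (((n : ℝ) + ν) / 2)))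
    ∧ ∫ x : Fin n → Fin m → ℝ, supLik m n ν σ2 ρ2 x / capC m n ν σ2 ρ2 = 1 := by
  have hm' : (1 : ℝ) ≤ m := by exact_mod_cast hm
  have hν0 : 0 < ν := by linarith
  have hclosed := supLik_div_capC_eq hν hν0 hσ hρ (n := n)
  refine ⟨hclosed, ?_⟩
  simp_rw [hclosed]
  exact integral_lnml_closed_form_eq_one hν hν0 hσ hρ
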